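/- Let V^ℂ = ℂ ⊗_ℝ V with conjugation u ↦ ū, and extend Ω ℂ-bilinearly to V^ℂ. Then the assignment F ↦ (D, j̃′), where D := F ∩ V and j̃′ is the unique compatible complex structure on the symplectic quotient (D^⊥/D, Ω′) whose +i-eigenspace in (D^⊥/D)^ℂ is the image F′ of F under the projection p : (D^⊥)^ℂ → (D^⊥/D)^ℂ, is a bijection between the set of complex Lagrangian subspaces F of (V,Ω) and the set of pairs (D, j̃′) consisting of a real isotropic subspace D ⊆ V and a compatible complex structure j̃′ on (D^⊥/D, Ω′). In particular, for a complex Lagrangian F: D = F ∩ V is isotropic, F ∩ F̄ = D^ℂ, (D^⊥)^ℂ = F + F̄, (D^⊥/D)^ℂ = F′ ⊕ F̄′, and such a j̃′ exists and is unique; conversely, for any pair (D, j̃′), F := p⁻¹(F′) with F′ the +i-eigenspace of the ℂ-linear extension of j̃′ is a complex Lagrangian with F ∩ V = D. -/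

import Mathlib

open scoped TensorProduct

/-- The inclusion `ι : V → V^ℂ = ℂ ⊗_ℝ V`, `v ↦ 1 ⊗ v`. -/
noncomputable def iotaC {V : Type*} [AddCommGroup V] [Module ℝ V] :
    V →ₗ[ℝ] ℂ ⊗[ℝ] V :=
  (TensorProduct.mk ℝ ℂ V) 1

/-- The conjugation `u ↦ ū` on `V^ℂ = ℂ ⊗_ℝ V`. -/
noncomputable def conjC {V : Type*} [AddCommGroup V] [Module ℝ V] :
    ℂ ⊗[ℝ] V →ₗ[ℝ] ℂ ⊗[ℝ] V :=
  TensorProduct.map Complex.conjAe.toLinearMap LinearMap.id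

/-- A complex Lagrangian subspace of `(V,Ω)`: an `n`-dimensional `ℂ`-subspace of
`V^ℂ` (where `dim_ℝ V = 2n`) on which the `ℂ`-bilinear extension `ΩC` of `Ω`
vanishes. -/
def IsCLagrangian {V : Type*} [AddCommGroup V] [Module ℝ V]
    (ΩC : ℂ ⊗[ℝ] V →ₗ[ℂ] ℂ ⊗[ℝ] V →ₗ[ℂ] ℂ) (F : Submodule ℂ (ℂ ⊗[ℝ] V)) : Prop :=
  (∀ x ∈ F, ∀ y ∈ F, ΩC x y = 0)
  ∧ Module.finrank ℝ V = 2 * Module.finrank ℂ ↥F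

/-- The real part `D = F ∩ V` of a complex subspace `F ⊆ V^ℂ`. -/
noncomputable def realPartOf {V : Type*} [AddCommGroup V] [Module ℝ V]
    (F : Submodule ℂ (ℂ ⊗[ℝ] V)) : Submodule ℝ V :=
  Submodule.comap iotaC (F.restrictScalars ℝ)

/-- The symplectic orthogonal `D^⊥`. -/
def symplOrth {V : Type*} [AddCommGroup V] [Module ℝ V]
    (Ω : V →ₗ[ℝ] V →ₗ[ℝ] ℝ) (D : Submodule ℝ V) : Submodule ℝ V where
  carrier := {v | ∀ w ∈ D, Ω v w = 0}
  add_mem' := by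
    intro a b ha hb w hw
    simp [map_add, LinearMap.add_apply, ha w hw, hb w hw]
  zero_mem' := by intro w hw; simp
  smul_mem' := by
    intro c x hx w hw
    simp [map_smul, LinearMap.smul_apply, hx w hw]

/-- The symplectic quotient `D^⊥/D`. -/
abbrev symplQuot {V : Type*} [AddCommGroup V] [Module ℝ V]
    (Ω : V →ₗ[ℝ] V →ₗ[ℝ] ℝ) (D : Submodule ℝ V) :=
  ↥(symplOrth Ω D) ⧸ (D.comap (symplOrth Ω D).subtype)

/-- The projection `π : D^⊥ → D^⊥/D`. -/
def symplProj {V : Type*} [AddCommGroup V] [Module ℝ V]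
    (Ω : V →ₗ[ℝ] V →ₗ[ℝ] ℝ) (D : Submodule ℝ V) :
    ↥(symplOrth Ω D) →ₗ[ℝ] symplQuot Ω D :=
  (D.comap (symplOrth Ω D).subtype).mkQ

/-- `j̃′` is a compatible complex structure on the symplectic quotient
`(D^⊥/D, Ω′)`: it squares to `−Id` and preserves the induced form `Ω′`. -/
def IsCompatQuot {V : Type*} [AddCommGroup V] [Module ℝ V]
    (Ω : V →ₗ[ℝ] V →ₗ[ℝ] ℝ) (D : Submodule ℝ V)
    (jq : Module.End ℝ (symplQuot Ω D)) : Prop :=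
  jq * jq = -1
  ∧ ∀ Ω' : symplQuot Ω D → symplQuot Ω D → ℝ,
      (∀ a b : ↥(symplOrth Ω D),
        Ω' (symplProj Ω D a) (symplProj Ω D b) = Ω (a : V) (b : V)) →
      ∀ x y, Ω' (jq x) (jq y) = Ω' x y

/-- `F′ = p(F)` is the `+i`-eigenspace of (the complexification of) `j̃′`:
for `x = 1⊗a + i⊗b ∈ F` (`a, b ∈ D^⊥`) one has `j̃′(πa) = −πb` and
`j̃′(πb) = πa`. -/
def EigCond {V : Type*} [AddCommGroup V] [Module ℝ V]
    (Ω : V →ₗ[ℝ] V →ₗ[ℝ] ℝ) (F : Submodule ℂ (ℂ ⊗[ℝ] V)) (D : Submodule ℝ V)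
    (jq : Module.End ℝ (symplQuot Ω D)) : Prop :=
  ∀ a b : ↥(symplOrth Ω D),
    ((1 : ℂ) ⊗ₜ[ℝ] (a : V) + Complex.I ⊗ₜ[ℝ] (b : V) ∈ F) →
    jq (symplProj Ω D a) = -(symplProj Ω D b)
    ∧ jq (symplProj Ω D b) = symplProj Ω D a

section Complexification

variable {V : Type*} [AddCommGroup V] [Module ℝ V]

/-- The vector `a + i b` of `V^ℂ`. -/
noncomputable def mkC (a b : V) : ℂ ⊗[ℝ] V :=
  (1 : ℂ) ⊗ₜ[ℝ] a + Complex.I ⊗ₜ[ℝ] b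

lemma mkC_add (a b c d : V) : mkC a b + mkC c d = mkC (a + c) (b + d) := by
  simp only [mkC, TensorProduct.tmul_add]
  abel

lemma mkC_neg (a b : V) : -mkC a b = mkC (-a) (-b) := by
  simp only [mkC, TensorProduct.tmul_neg]
  abel

lemma mkC_sub (a b c d : V) : mkC a b - mkC c d = mkC (a - c) (b - d) := by
  rw [sub_eq_add_neg, mkC_neg, mkC_add, sub_eq_add_neg, sub_eq_add_neg]

lemma tmul_eq_mkC (z : ℂ) (v : V) : z ⊗ₜ[ℝ] v = mkC (z.re • v) (z.im • v) := by
  rw [mkC, ← TensorProduct.smul_tmul, ← TensorProduct.smul_tmul, ← TensorProduct.add_tmul]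
  congr 1
  apply Complex.ext <;> simp

lemma smul_mkC (z : ℂ) (a b : V) :
    z • mkC a b = mkC (z.re • a - z.im • b) (z.im • a + z.re • b) := by
  have h : z • mkC a b = z ⊗ₜ[ℝ] a + (z * Complex.I) ⊗ₜ[ℝ] b := by
    simp [mkC, TensorProduct.smul_tmul', smul_add]
  rw [h, tmul_eq_mkC, tmul_eq_mkC, mkC_add]
  simp [sub_eq_add_neg]

lemma I_smul_mkC (a b : V) : Complex.I • mkC a b = mkC (-b) a := by
  simp [smul_mkC]

lemma exists_eq_mkC (x : ℂ ⊗[ℝ] V) : ∃ a b : V, x = mkC a b := by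
  induction x with
  | zero => exact ⟨0, 0, by simp [mkC]⟩
  | tmul z v => exact ⟨_, _, tmul_eq_mkC z v⟩
  | add x y hx hy =>
    obtain ⟨a, b, rfl⟩ := hx
    obtain ⟨c, d, rfl⟩ := hy
    exact ⟨_, _, mkC_add a b c d⟩

lemma mkC_inj {a b c d : V} (h : mkC a b = mkC c d) : a = c ∧ b = d := by
  have hre := congrArg (fun x => TensorProduct.lid ℝ V (LinearMap.rTensor V Complex.reLm x)) h
  have him := congrArg (fun x => TensorProduct.lid ℝ V (LinearMap.rTensor V Complex.imLm x)) h
  simp only [mkC, map_add, LinearMap.rTensor_tmul, TensorProduct.lid_tmul] at hre him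
  simp at hre him
  exact ⟨hre, him⟩

lemma conjC_mkC (a b : V) : conjC (mkC a b) = mkC a (-b) := by
  simp [conjC, mkC, TensorProduct.neg_tmul, TensorProduct.tmul_neg]

lemma iotaC_eq_mkC (a : V) : iotaC a = mkC a 0 := by
  simp [iotaC, mkC]

lemma mkC_eq_iotaC (a b : V) : mkC a b = iotaC a + Complex.I • iotaC b := by
  rw [iotaC_eq_mkC, iotaC_eq_mkC, I_smul_mkC, mkC_add]
  simp

lemma iotaC_eq_half_add (a b : V) : iotaC a = (2⁻¹ : ℂ) • (mkC a b + mkC a (-b)) := by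
  rw [iotaC_eq_mkC, mkC_add, ← two_smul ℝ a, add_neg_cancel, smul_mkC]
  simp [smul_smul]

lemma eq_top_of_iotaC_mem {T : Submodule ℂ (ℂ ⊗[ℝ] V)} (h : ∀ v, iotaC v ∈ T) : T = ⊤ := by
  refine eq_top_iff.2 fun x _ => ?_
  obtain ⟨a, b, rfl⟩ := exists_eq_mkC x
  rw [mkC_eq_iotaC]
  exact add_mem (h a) (T.smul_mem _ (h b))

/-- The complexification `D^ℂ` of a real subspace `D`. -/
def cplxSubmodule (D : Submodule ℝ V) : Submodule ℂ (ℂ ⊗[ℝ] V) where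
  carrier := {x | ∃ a ∈ D, ∃ b ∈ D, x = mkC a b}
  add_mem' := by
    rintro _ _ ⟨a, ha, b, hb, rfl⟩ ⟨c, hc, d, hd, rfl⟩
    exact ⟨_, D.add_mem ha hc, _, D.add_mem hb hd, mkC_add ..⟩
  zero_mem' := ⟨0, D.zero_mem, 0, D.zero_mem, by simp [mkC]⟩
  smul_mem' := by
    rintro z _ ⟨a, ha, b, hb, rfl⟩
    exact ⟨_, D.sub_mem (D.smul_mem _ ha) (D.smul_mem _ hb),
      _, D.add_mem (D.smul_mem _ ha) (D.smul_mem _ hb), smul_mkC ..⟩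

lemma mkC_mem_cplxSubmodule {D : Submodule ℝ V} {a b : V} :
    mkC a b ∈ cplxSubmodule D ↔ a ∈ D ∧ b ∈ D := by
  constructor
  · rintro ⟨c, hc, d, hd, h⟩
    obtain ⟨rfl, rfl⟩ := mkC_inj h
    exact ⟨hc, hd⟩
  · rintro ⟨ha, hb⟩
    exact ⟨a, ha, b, hb, rfl⟩

lemma span_iotaC_image (D : Submodule ℝ V) :
    Submodule.span ℂ (iotaC '' (D : Set V)) = cplxSubmodule D := by
  apply le_antisymm
  · rw [Submodule.span_le]
    rintro _ ⟨a, ha, rfl⟩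
    rw [iotaC_eq_mkC]
    exact mkC_mem_cplxSubmodule.2 ⟨ha, D.zero_mem⟩
  · rintro _ ⟨a, ha, b, hb, rfl⟩
    rw [mkC_eq_iotaC]
    exact add_mem (Submodule.subset_span ⟨a, ha, rfl⟩)
      (Submodule.smul_mem _ _ (Submodule.subset_span ⟨b, hb, rfl⟩))

lemma mkC_mem_span_conjC {F : Submodule ℂ (ℂ ⊗[ℝ] V)} {a b : V} :
    mkC a b ∈ Submodule.span ℂ (conjC '' (F : Set (ℂ ⊗[ℝ] V))) ↔ mkC a (-b) ∈ F := by
  constructor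
  · intro h
    suffices H : ∀ x ∈ Submodule.span ℂ (conjC '' (F : Set (ℂ ⊗[ℝ] V))), conjC x ∈ F by
      simpa [conjC_mkC] using H _ h
    intro x hx
    induction hx using Submodule.span_induction with
    | mem x hx =>
      obtain ⟨y, hy, rfl⟩ := hx
      obtain ⟨c, d, rfl⟩ := exists_eq_mkC y
      simpa [conjC_mkC] using hy
    | zero => simp
    | add x y _ _ hx hy => rw [map_add]; exact F.add_mem hx hy
    | smul z x _ hx =>
      obtain ⟨c, d, rfl⟩ := exists_eq_mkC x
      have := F.smul_mem (starRingEnd ℂ z) hx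
      rw [conjC_mkC, smul_mkC] at this
      rw [smul_mkC, conjC_mkC]
      convert this using 2 <;> simp
      abel
  · intro h
    exact Submodule.subset_span ⟨_, h, by simp [conjC_mkC]⟩

lemma mem_realPartOf {F : Submodule ℂ (ℂ ⊗[ℝ] V)} {a : V} :
    a ∈ realPartOf F ↔ mkC a 0 ∈ F := by
  rw [← iotaC_eq_mkC]
  rfl

lemma mkC_swap_mem {F : Submodule ℂ (ℂ ⊗[ℝ] V)} {a b : V} (h : mkC a b ∈ F) :
    mkC (-b) a ∈ F := by
  rw [← I_smul_mkC]
  exact F.smul_mem _ h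

lemma real_smul_mkC_mem {F : Submodule ℂ (ℂ ⊗[ℝ] V)} {a b : V} (r : ℝ) (h : mkC a b ∈ F) :
    mkC (r • a) (r • b) ∈ F := by
  have := F.smul_mem (r : ℂ) h
  rw [smul_mkC] at this
  simpa using this

lemma sub_mem_realPartOf {F : Submodule ℂ (ℂ ⊗[ℝ] V)} {a b c : V}
    (hb : mkC a b ∈ F) (hc : mkC a c ∈ F) : b - c ∈ realPartOf F := by
  rw [mem_realPartOf]
  have h := F.sub_mem hb hc
  rw [mkC_sub] at h
  have h := F.neg_mem (mkC_swap_mem h)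
  rw [mkC_neg] at h
  simpa using h

lemma inf_conjC_eq (F : Submodule ℂ (ℂ ⊗[ℝ] V)) :
    F ⊓ Submodule.span ℂ (conjC '' (F : Set (ℂ ⊗[ℝ] V))) = cplxSubmodule (realPartOf F) := by
  ext x
  obtain ⟨a, b, rfl⟩ := exists_eq_mkC x
  rw [Submodule.mem_inf, mkC_mem_span_conjC, mkC_mem_cplxSubmodule, mem_realPartOf,
    mem_realPartOf]
  constructor
  · rintro ⟨h₁, h₂⟩
    constructor
    · rw [← iotaC_eq_mkC, iotaC_eq_half_add a b]
      exact F.smul_mem _ (F.add_mem h₁ h₂)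
    · have h := F.smul_mem (2⁻¹ * -Complex.I : ℂ) (F.sub_mem h₁ h₂)
      rw [mkC_sub, smul_mkC] at h
      convert h using 2
      · rw [sub_neg_eq_add, ← two_smul ℝ b, sub_self, smul_smul]
        norm_num
      · norm_num
  · rintro ⟨ha, hb⟩
    have key : ∀ c : V, mkC c 0 ∈ F → mkC 0 c ∈ F := fun c hc => by
      simpa using mkC_swap_mem hc
    have h₁ := F.add_mem ha (key b hb)
    have h₂ := F.sub_mem ha (key b hb)
    rw [mkC_add] at h₁
    rw [mkC_sub] at h₂
    simp only [add_zero, zero_add, sub_zero, zero_sub] at h₁ h₂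
    exact ⟨h₁, h₂⟩

end Complexification

section Symplectic

variable {V : Type*} [AddCommGroup V] [Module ℝ V] {Ω : V →ₗ[ℝ] V →ₗ[ℝ] ℝ}

lemma mem_symplOrth {D : Submodule ℝ V} {v : V} :
    v ∈ symplOrth Ω D ↔ ∀ w ∈ D, Ω v w = 0 :=
  Iff.rfl

lemma symplOrth_eq_orthogonal (hΩalt : ∀ v, Ω v v = 0) (D : Submodule ℝ V) :
    symplOrth Ω D = LinearMap.BilinForm.orthogonal Ω D := by
  ext v
  rw [mem_symplOrth, LinearMap.BilinForm.mem_orthogonal_iff]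
  have hr : Ω.IsRefl := LinearMap.IsAlt.isRefl hΩalt
  exact forall₂_congr fun w _ => hr.eq_iff

lemma nondegenerate_of_alt {K W : Type*} [Field K] [AddCommGroup W] [Module K W]
    {B : W →ₗ[K] W →ₗ[K] K} (halt : ∀ v, B v v = 0)
    (h : ∀ v, (∀ w, B v w = 0) → v = 0) : B.Nondegenerate :=
  (LinearMap.IsRefl.nondegenerate_iff_separatingLeft (LinearMap.IsAlt.isRefl halt)).2 h

lemma symplOrth_symplOrth [FiniteDimensional ℝ V] (hΩalt : ∀ v, Ω v v = 0)
    (hΩnondeg : ∀ v, (∀ w, Ω v w = 0) → v = 0) (D : Submodule ℝ V) :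
    symplOrth Ω (symplOrth Ω D) = D := by
  rw [symplOrth_eq_orthogonal hΩalt, symplOrth_eq_orthogonal hΩalt]
  exact LinearMap.BilinForm.orthogonal_orthogonal (nondegenerate_of_alt hΩalt hΩnondeg)
    (LinearMap.IsAlt.isRefl hΩalt) D

lemma symplProj_surjective (D : Submodule ℝ V) : Function.Surjective (symplProj Ω D) :=
  Submodule.mkQ_surjective _

lemma symplProj_eq_iff {D : Submodule ℝ V} {a b : symplOrth Ω D} :
    symplProj Ω D a = symplProj Ω D b ↔ (a - b : V) ∈ D := by
  simp [symplProj, Submodule.Quotient.eq]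

lemma symplProj_eq_zero_iff {D : Submodule ℝ V} {a : symplOrth Ω D} :
    symplProj Ω D a = 0 ↔ (a : V) ∈ D := by
  simp [symplProj]

/-- The form induced by `Ω` on `D^⊥/D`. -/
noncomputable def quotForm (Ω : V →ₗ[ℝ] V →ₗ[ℝ] ℝ) (D : Submodule ℝ V)
    (x y : symplQuot Ω D) : ℝ :=
  Ω (Function.surjInv (symplProj_surjective D) x : symplOrth Ω D)
    (Function.surjInv (symplProj_surjective D) y : symplOrth Ω D)

lemma apply_eq_of_symplProj_eq (hΩalt : ∀ v, Ω v v = 0) {D : Submodule ℝ V}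
    {a a' b b' : symplOrth Ω D} (ha : symplProj Ω D a = symplProj Ω D a')
    (hb : symplProj Ω D b = symplProj Ω D b') : Ω (a : V) b = Ω (a' : V) b' := by
  have hr : Ω.IsRefl := LinearMap.IsAlt.isRefl hΩalt
  have h₁ : Ω (a - a' : V) (b : V) = 0 := hr _ _ (b.2 _ (symplProj_eq_iff.1 ha))
  have h₂ : Ω (a' : V) (b - b' : V) = 0 := a'.2 _ (symplProj_eq_iff.1 hb)
  rw [map_sub, LinearMap.sub_apply] at h₁
  rw [map_sub] at h₂
  linarith

lemma quotForm_symplProj (hΩalt : ∀ v, Ω v v = 0) (D : Submodule ℝ V)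
    (a b : symplOrth Ω D) :
    quotForm Ω D (symplProj Ω D a) (symplProj Ω D b) = Ω (a : V) (b : V) :=
  apply_eq_of_symplProj_eq hΩalt (Function.surjInv_eq _ _) (Function.surjInv_eq _ _)

lemma IsCompatQuot.apply_apply {D : Submodule ℝ V} {jq : Module.End ℝ (symplQuot Ω D)}
    (h : IsCompatQuot Ω D jq) (x : symplQuot Ω D) : jq (jq x) = -x :=
  LinearMap.congr_fun h.1 x

lemma IsCompatQuot.apply_eq (hΩalt : ∀ v, Ω v v = 0) {D : Submodule ℝ V}
    {jq : Module.End ℝ (symplQuot Ω D)} (h : IsCompatQuot Ω D jq)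
    {a a' b b' : symplOrth Ω D} (ha : jq (symplProj Ω D a) = symplProj Ω D a')
    (hb : jq (symplProj Ω D b) = symplProj Ω D b') : Ω (a' : V) b' = Ω (a : V) b := by
  have := h.2 (quotForm Ω D) (quotForm_symplProj hΩalt D) (symplProj Ω D a) (symplProj Ω D b)
  rwa [ha, hb, quotForm_symplProj hΩalt, quotForm_symplProj hΩalt] at this

variable {ΩC : ℂ ⊗[ℝ] V →ₗ[ℂ] ℂ ⊗[ℝ] V →ₗ[ℂ] ℂ}

lemma formC_mkC (hΩC : ∀ v w : V, ΩC (iotaC v) (iotaC w) = (Ω v w : ℂ)) (a b c d : V) :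
    ΩC (mkC a b) (mkC c d) = ⟨Ω a c - Ω b d, Ω a d + Ω b c⟩ := by
  simp only [mkC_eq_iotaC, map_add, map_smul, LinearMap.add_apply, LinearMap.smul_apply, hΩC]
  apply Complex.ext <;> simp <;> ring

lemma formC_mkC_eq_zero_iff (hΩC : ∀ v w : V, ΩC (iotaC v) (iotaC w) = (Ω v w : ℂ))
    {a b c d : V} :
    ΩC (mkC a b) (mkC c d) = 0 ↔ Ω a c = Ω b d ∧ Ω a d = -Ω b c := by
  rw [formC_mkC hΩC, Complex.ext_iff]
  simp [sub_eq_zero, add_eq_zero_iff_eq_neg]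

lemma formC_alt (hΩalt : ∀ v, Ω v v = 0)
    (hΩC : ∀ v w : V, ΩC (iotaC v) (iotaC w) = (Ω v w : ℂ)) (x : ℂ ⊗[ℝ] V) : ΩC x x = 0 := by
  obtain ⟨a, b, rfl⟩ := exists_eq_mkC x
  rw [formC_mkC_eq_zero_iff hΩC, hΩalt, hΩalt]
  exact ⟨rfl, (LinearMap.IsAlt.neg hΩalt b a).symm⟩

lemma formC_nondegenerate (hΩalt : ∀ v, Ω v v = 0)
    (hΩnondeg : ∀ v, (∀ w, Ω v w = 0) → v = 0)
    (hΩC : ∀ v w : V, ΩC (iotaC v) (iotaC w) = (Ω v w : ℂ)) : ΩC.Nondegenerate := by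
  refine nondegenerate_of_alt (formC_alt hΩalt hΩC) fun x hx => ?_
  obtain ⟨a, b, rfl⟩ := exists_eq_mkC x
  have h := fun w => (formC_mkC_eq_zero_iff hΩC).1 (hx (mkC w 0))
  have ha : a = 0 := hΩnondeg a fun w => by simpa using (h w).1
  have hb : b = 0 := hΩnondeg b fun w => by simpa using (h w).2
  simp [mkC, ha, hb]

lemma isCLagrangian_iff [FiniteDimensional ℝ V] (hΩalt : ∀ v, Ω v v = 0)
    (hΩnondeg : ∀ v, (∀ w, Ω v w = 0) → v = 0)
    (hΩC : ∀ v w : V, ΩC (iotaC v) (iotaC w) = (Ω v w : ℂ))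
    {F : Submodule ℂ (ℂ ⊗[ℝ] V)} :
    IsCLagrangian ΩC F ↔ LinearMap.BilinForm.orthogonal ΩC F = F := by
  have hdim := LinearMap.BilinForm.finrank_orthogonal
    (formC_nondegenerate hΩalt hΩnondeg hΩC) F
  have hF := Submodule.finrank_le F
  rw [Module.finrank_baseChange] at hdim hF
  constructor
  · rintro ⟨h₁, h₂⟩
    refine (Submodule.eq_of_le_of_finrank_eq (fun x hx => ?_) ?_).symm
    · exact fun y hy => h₁ y hy x hx
    · omega
  · intro h
    refine ⟨fun x hx y hy => ?_, ?_⟩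
    · rw [← h] at hy
      exact hy x hx
    · rw [h] at hdim
      omega

variable {F : Submodule ℂ (ℂ ⊗[ℝ] V)}

lemma IsCLagrangian.eqs (hΩC : ∀ v w : V, ΩC (iotaC v) (iotaC w) = (Ω v w : ℂ))
    (hF : IsCLagrangian ΩC F) {a b c d : V} (h : mkC a b ∈ F) (h' : mkC c d ∈ F) :
    Ω a c = Ω b d ∧ Ω a d = -Ω b c :=
  (formC_mkC_eq_zero_iff hΩC).1 (hF.1 _ h _ h')

lemma IsCLagrangian.isotropic (hΩC : ∀ v w : V, ΩC (iotaC v) (iotaC w) = (Ω v w : ℂ))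
    (hF : IsCLagrangian ΩC F) : ∀ v ∈ realPartOf F, ∀ w ∈ realPartOf F, Ω v w = 0 := by
  intro v hv w hw
  simpa using (hF.eqs hΩC (mem_realPartOf.1 hv) (mem_realPartOf.1 hw)).1

lemma IsCLagrangian.mem_symplOrth (hΩC : ∀ v w : V, ΩC (iotaC v) (iotaC w) = (Ω v w : ℂ))
    (hF : IsCLagrangian ΩC F) {a b : V} (h : mkC a b ∈ F) :
    a ∈ symplOrth Ω (realPartOf F) ∧ b ∈ symplOrth Ω (realPartOf F) := by
  constructor <;> intro w hw
  · simpa using (hF.eqs hΩC h (mem_realPartOf.1 hw)).1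
  · simpa using (hF.eqs hΩC h (mem_realPartOf.1 hw)).2

/-- The real parts of the vectors of a complex Lagrangian `F` fill `D^⊥`. -/
lemma IsCLagrangian.exists_mkC_mem [FiniteDimensional ℝ V] (hΩalt : ∀ v, Ω v v = 0)
    (hΩnondeg : ∀ v, (∀ w, Ω v w = 0) → v = 0)
    (hΩC : ∀ v w : V, ΩC (iotaC v) (iotaC w) = (Ω v w : ℂ))
    (hF : IsCLagrangian ΩC F) {a : V} (ha : a ∈ symplOrth Ω (realPartOf F)) :
    ∃ b, mkC a b ∈ F := by
  let E : Submodule ℝ V :=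
    { carrier := {a | ∃ b, mkC a b ∈ F}
      add_mem' := by
        rintro a c ⟨b, h⟩ ⟨d, h'⟩
        exact ⟨b + d, mkC_add a b c d ▸ F.add_mem h h'⟩
      zero_mem' := ⟨0, by simp [mkC]⟩
      smul_mem' := by
        rintro r a ⟨b, h⟩
        exact ⟨r • b, real_smul_mkC_mem r h⟩ }
  have hE : symplOrth Ω E ≤ realPartOf F := by
    intro v hv
    rw [mem_realPartOf, ← (isCLagrangian_iff hΩalt hΩnondeg hΩC).1 hF]
    intro x hx
    obtain ⟨c, d, rfl⟩ := exists_eq_mkC x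
    have hc : Ω v c = 0 := hv c ⟨d, hx⟩
    have hd : Ω v d = 0 := hv d ⟨-c, by simpa [mkC_neg] using F.neg_mem (mkC_swap_mem hx)⟩
    refine (LinearMap.IsAlt.isRefl (formC_alt hΩalt hΩC)) _ _ ?_
    rw [formC_mkC_eq_zero_iff hΩC, hc, hd]
    simp
  have : a ∈ symplOrth Ω (symplOrth Ω E) := fun w hw => ha w (hE hw)
  rwa [symplOrth_symplOrth hΩalt hΩnondeg] at this

lemma IsCLagrangian.sup_conjC_eq [FiniteDimensional ℝ V] (hΩalt : ∀ v, Ω v v = 0)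
    (hΩnondeg : ∀ v, (∀ w, Ω v w = 0) → v = 0)
    (hΩC : ∀ v w : V, ΩC (iotaC v) (iotaC w) = (Ω v w : ℂ))
    (hF : IsCLagrangian ΩC F) :
    Submodule.span ℂ (iotaC '' ((symplOrth Ω (realPartOf F) : Submodule ℝ V) : Set V))
      = F ⊔ Submodule.span ℂ (conjC '' (F : Set (ℂ ⊗[ℝ] V))) := by
  apply le_antisymm
  · rw [Submodule.span_le]
    rintro _ ⟨a, ha, rfl⟩
    obtain ⟨b, hb⟩ := hF.exists_mkC_mem hΩalt hΩnondeg hΩC ha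
    rw [SetLike.mem_coe, iotaC_eq_half_add a b]
    refine Submodule.smul_mem _ _ (Submodule.add_mem_sup hb ?_)
    rw [mkC_mem_span_conjC, neg_neg]
    exact hb
  · rw [span_iotaC_image]
    refine sup_le (fun x hx => ?_) (fun x hx => ?_) <;>
      obtain ⟨a, b, rfl⟩ := exists_eq_mkC x <;> rw [mkC_mem_cplxSubmodule]
    · exact hF.mem_symplOrth hΩC hx
    · have h := hF.mem_symplOrth hΩC (mkC_mem_span_conjC.1 hx)
      rwa [neg_mem_iff] at h

lemma IsCLagrangian.exists_symplOrth [FiniteDimensional ℝ V] (hΩalt : ∀ v, Ω v v = 0)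
    (hΩnondeg : ∀ v, (∀ w, Ω v w = 0) → v = 0)
    (hΩC : ∀ v w : V, ΩC (iotaC v) (iotaC w) = (Ω v w : ℂ))
    (hF : IsCLagrangian ΩC F) (a : symplOrth Ω (realPartOf F)) :
    ∃ b : symplOrth Ω (realPartOf F), mkC (a : V) b ∈ F := by
  obtain ⟨b, hb⟩ := hF.exists_mkC_mem hΩalt hΩnondeg hΩC a.2
  exact ⟨⟨b, (hF.mem_symplOrth hΩC hb).2⟩, hb⟩

lemma symplProj_eq_of_mkC_mem {a b c : symplOrth Ω (realPartOf F)}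
    (hb : mkC (a : V) b ∈ F) (hc : mkC (a : V) c ∈ F) :
    symplProj Ω (realPartOf F) b = symplProj Ω (realPartOf F) c :=
  symplProj_eq_iff.2 (sub_mem_realPartOf hb hc)

/-- A complex Lagrangian `F` induces an endomorphism of `D^⊥/D` with `πa ↦ -πb` for
`a + i b ∈ F`. -/
lemma IsCLagrangian.exists_quotEnd [FiniteDimensional ℝ V] (hΩalt : ∀ v, Ω v v = 0)
    (hΩnondeg : ∀ v, (∀ w, Ω v w = 0) → v = 0)
    (hΩC : ∀ v w : V, ΩC (iotaC v) (iotaC w) = (Ω v w : ℂ))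
    (hF : IsCLagrangian ΩC F) :
    ∃ jq : Module.End ℝ (symplQuot Ω (realPartOf F)),
      ∀ a b : symplOrth Ω (realPartOf F), mkC (a : V) b ∈ F →
        jq (symplProj Ω (realPartOf F) a) = -symplProj Ω (realPartOf F) b := by
  choose g hg using hF.exists_symplOrth hΩalt hΩnondeg hΩC
  let f : symplOrth Ω (realPartOf F) →ₗ[ℝ] symplQuot Ω (realPartOf F) :=
    { toFun := fun a => -symplProj Ω (realPartOf F) (g a)
      map_add' := fun a c => by
        rw [← neg_add, ← map_add, neg_inj]
        refine symplProj_eq_of_mkC_mem (hg (a + c)) ?_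
        simpa [mkC_add] using F.add_mem (hg a) (hg c)
      map_smul' := fun r a => by
        rw [RingHom.id_apply, smul_neg, ← map_smul, neg_inj]
        refine symplProj_eq_of_mkC_mem (hg (r • a)) ?_
        exact real_smul_mkC_mem r (hg a) }
  have hf : ∀ a b : symplOrth Ω (realPartOf F), mkC (a : V) b ∈ F →
      f a = -symplProj Ω (realPartOf F) b := fun a b h =>
    congrArg Neg.neg (symplProj_eq_of_mkC_mem (hg a) h)
  refine ⟨Submodule.liftQ _ f fun a ha => ?_, fun a b h => ?_⟩
  · rw [LinearMap.mem_ker, hf a 0 (by simpa using mem_realPartOf.1 ha), map_zero, neg_zero]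
  · rw [← hf a b h]
    exact Submodule.liftQ_apply _ f a

lemma IsCLagrangian.existsUnique_compat [FiniteDimensional ℝ V] (hΩalt : ∀ v, Ω v v = 0)
    (hΩnondeg : ∀ v, (∀ w, Ω v w = 0) → v = 0)
    (hΩC : ∀ v w : V, ΩC (iotaC v) (iotaC w) = (Ω v w : ℂ))
    (hF : IsCLagrangian ΩC F) :
    ∃! jq : Module.End ℝ (symplQuot Ω (realPartOf F)),
      IsCompatQuot Ω (realPartOf F) jq ∧ EigCond Ω F (realPartOf F) jq := by
  obtain ⟨jq, hj⟩ := hF.exists_quotEnd hΩalt hΩnondeg hΩC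
  have hj' : ∀ a b : symplOrth Ω (realPartOf F), mkC (a : V) b ∈ F →
      jq (symplProj Ω (realPartOf F) b) = symplProj Ω (realPartOf F) a := by
    intro a b h
    rw [hj b (-a), map_neg, neg_neg]
    simpa [mkC_neg] using F.neg_mem (mkC_swap_mem h)
  refine ⟨jq, ⟨⟨?_, ?_⟩, fun a b h => ⟨hj a b h, hj' a b h⟩⟩, ?_⟩
  · refine LinearMap.ext fun x => ?_
    obtain ⟨a, rfl⟩ := symplProj_surjective _ x
    obtain ⟨b, h⟩ := hF.exists_symplOrth hΩalt hΩnondeg hΩC a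
    simp [hj a b h, hj' a b h]
  · intro Ω' hΩ' x y
    obtain ⟨a, rfl⟩ := symplProj_surjective _ x
    obtain ⟨c, rfl⟩ := symplProj_surjective _ y
    obtain ⟨b, h⟩ := hF.exists_symplOrth hΩalt hΩnondeg hΩC a
    obtain ⟨d, h'⟩ := hF.exists_symplOrth hΩalt hΩnondeg hΩC c
    rw [hj a b h, hj c d h', ← map_neg, ← map_neg, hΩ', hΩ', (hF.eqs hΩC h h').1]
    simp
  · rintro kq ⟨-, hk⟩
    refine LinearMap.ext fun x => ?_
    obtain ⟨a, rfl⟩ := symplProj_surjective _ x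
    obtain ⟨b, h⟩ := hF.exists_symplOrth hΩalt hΩnondeg hΩC a
    rw [hj a b h, (hk a b h).1]

lemma baseChange_mkC_eigen {W : Type*} [AddCommGroup W] [Module ℝ W] (j : Module.End ℝ W)
    {a b : W} (ha : j a = -b) (hb : j b = a) :
    j.baseChange ℂ (mkC a b) = Complex.I • mkC a b
      ∧ j.baseChange ℂ (mkC a (-b)) = -Complex.I • mkC a (-b) := by
  have h : ∀ c d : W, j.baseChange ℂ (mkC c d) = mkC (j c) (j d) := fun c d => by simp [mkC]
  rw [h, h, neg_smul, I_smul_mkC, I_smul_mkC, mkC_neg, map_neg, ha, hb, neg_neg]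
  exact ⟨rfl, rfl⟩

lemma IsCLagrangian.isCompl [FiniteDimensional ℝ V] (hΩalt : ∀ v, Ω v v = 0)
    (hΩnondeg : ∀ v, (∀ w, Ω v w = 0) → v = 0)
    (hΩC : ∀ v w : V, ΩC (iotaC v) (iotaC w) = (Ω v w : ℂ))
    (hF : IsCLagrangian ΩC F) :
    IsCompl
      (Submodule.span ℂ {y : ℂ ⊗[ℝ] symplQuot Ω (realPartOf F) |
        ∃ a b : ↥(symplOrth Ω (realPartOf F)), mkC (a : V) (b : V) ∈ F
          ∧ y = mkC (symplProj Ω (realPartOf F) a) (symplProj Ω (realPartOf F) b)})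
      (Submodule.span ℂ {y : ℂ ⊗[ℝ] symplQuot Ω (realPartOf F) |
        ∃ a b : ↥(symplOrth Ω (realPartOf F)), mkC (a : V) (b : V) ∈ F
          ∧ y = mkC (symplProj Ω (realPartOf F) a) (-symplProj Ω (realPartOf F) b)}) := by
  obtain ⟨jq, ⟨-, hj⟩, -⟩ := hF.existsUnique_compat hΩalt hΩnondeg hΩC
  constructor
  · refine Disjoint.mono ?_ ?_ (Module.End.disjoint_genEigenspace (jq.baseChange ℂ)
      (μ₁ := Complex.I) (μ₂ := -Complex.I) (by simp [self_eq_neg]) 1 1)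
    all_goals
      rw [Submodule.span_le]
      rintro _ ⟨a, b, h, rfl⟩
      have he := baseChange_mkC_eigen jq (hj a b h).1 (hj a b h).2
      rw [SetLike.mem_coe, Module.End.mem_genEigenspace_one]
      first | exact he.1 | exact he.2
  · rw [codisjoint_iff]
    refine eq_top_of_iotaC_mem fun u => ?_
    obtain ⟨a, rfl⟩ := symplProj_surjective _ u
    obtain ⟨b, h⟩ := hF.exists_symplOrth hΩalt hΩnondeg hΩC a
    rw [iotaC_eq_half_add _ (symplProj Ω (realPartOf F) b)]
    exact Submodule.smul_mem _ _ (Submodule.add_mem_sup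
      (Submodule.subset_span ⟨a, b, h, rfl⟩) (Submodule.subset_span ⟨a, b, h, rfl⟩))

/-- The preimage in `(D^⊥)^ℂ` of the `+i`-eigenspace of `jq`. -/
def eigPreimage (Ω : V →ₗ[ℝ] V →ₗ[ℝ] ℝ) (D : Submodule ℝ V)
    (jq : Module.End ℝ (symplQuot Ω D)) : Submodule ℂ (ℂ ⊗[ℝ] V) where
  carrier := {x | ∃ a b : symplOrth Ω D, x = mkC (a : V) (b : V)
    ∧ jq (symplProj Ω D a) = -(symplProj Ω D b)
    ∧ jq (symplProj Ω D b) = symplProj Ω D a}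
  add_mem' := by
    rintro _ _ ⟨a, b, rfl, h₁, h₂⟩ ⟨c, d, rfl, h₃, h₄⟩
    refine ⟨a + c, b + d, mkC_add .., ?_, ?_⟩
    · simp only [map_add, h₁, h₃, neg_add]
    · simp only [map_add, h₂, h₄]
  zero_mem' := ⟨0, 0, by simp [mkC], by simp, by simp⟩
  smul_mem' := by
    rintro z _ ⟨a, b, rfl, h₁, h₂⟩
    refine ⟨z.re • a - z.im • b, z.im • a + z.re • b, smul_mkC .., ?_, ?_⟩
    · simp only [map_add, map_sub, map_smul, h₁, h₂, smul_neg, neg_add]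
      abel
    · simp only [map_add, map_sub, map_smul, h₁, h₂, smul_neg]
      abel

lemma mkC_mem_eigPreimage {D : Submodule ℝ V} {jq : Module.End ℝ (symplQuot Ω D)}
    {a b : symplOrth Ω D} :
    mkC (a : V) (b : V) ∈ eigPreimage Ω D jq ↔
      jq (symplProj Ω D a) = -(symplProj Ω D b)
        ∧ jq (symplProj Ω D b) = symplProj Ω D a := by
  constructor
  · rintro ⟨c, d, h, h'⟩
    obtain ⟨h₁, h₂⟩ := mkC_inj h
    obtain rfl := Subtype.ext h₁
    obtain rfl := Subtype.ext h₂
    exact h'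
  · exact fun h => ⟨a, b, rfl, h⟩

lemma IsCompatQuot.mkC_mem_eigPreimage_of_eq {D : Submodule ℝ V}
    {jq : Module.End ℝ (symplQuot Ω D)} (hj : IsCompatQuot Ω D jq) {a b : symplOrth Ω D}
    (h : jq (symplProj Ω D b) = symplProj Ω D a) :
    mkC (a : V) (b : V) ∈ eigPreimage Ω D jq :=
  mkC_mem_eigPreimage.2 ⟨by rw [← h, hj.apply_apply], h⟩

lemma IsCompatQuot.realPartOf_eigPreimage {D : Submodule ℝ V}
    (hD : ∀ v ∈ D, ∀ w ∈ D, Ω v w = 0)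
    {jq : Module.End ℝ (symplQuot Ω D)} (hj : IsCompatQuot Ω D jq) :
    realPartOf (eigPreimage Ω D jq) = D := by
  ext v
  rw [mem_realPartOf]
  constructor
  · rintro ⟨a, b, h, -, h'⟩
    obtain ⟨rfl, hb⟩ := mkC_inj h
    rw [← symplProj_eq_zero_iff, ← h', symplProj_eq_zero_iff.2 (hb ▸ D.zero_mem), map_zero]
  · intro hv
    have h := hj.mkC_mem_eigPreimage_of_eq (a := ⟨v, hD v hv⟩) (b := 0)
      (by rw [map_zero, map_zero, eq_comm, symplProj_eq_zero_iff]; exact hv)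
    simpa using h

lemma IsCompatQuot.isCLagrangian_eigPreimage [FiniteDimensional ℝ V]
    (hΩalt : ∀ v, Ω v v = 0) (hΩnondeg : ∀ v, (∀ w, Ω v w = 0) → v = 0)
    (hΩC : ∀ v w : V, ΩC (iotaC v) (iotaC w) = (Ω v w : ℂ)) {D : Submodule ℝ V}
    (hD : ∀ v ∈ D, ∀ w ∈ D, Ω v w = 0)
    {jq : Module.End ℝ (symplQuot Ω D)} (hj : IsCompatQuot Ω D jq) :
    IsCLagrangian ΩC (eigPreimage Ω D jq) := by
  rw [isCLagrangian_iff hΩalt hΩnondeg hΩC]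
  have hrC := LinearMap.IsAlt.isRefl (formC_alt hΩalt hΩC)
  apply le_antisymm
  · intro x hx
    obtain ⟨a, b, rfl⟩ := exists_eq_mkC x
    have horth : ∀ c d : V, mkC c d ∈ eigPreimage Ω D jq → Ω a c = Ω b d ∧ Ω a d = -Ω b c :=
      fun c d h => (formC_mkC_eq_zero_iff hΩC).1 (hrC _ _ (hx _ h))
    have hDF : ∀ w ∈ D, mkC w 0 ∈ eigPreimage Ω D jq := fun w hw => by
      rwa [← mem_realPartOf, hj.realPartOf_eigPreimage hD]
    have ha : a ∈ symplOrth Ω D := fun w hw => by simpa using (horth w 0 (hDF w hw)).1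
    have hb : b ∈ symplOrth Ω D := fun w hw => by simpa using (horth w 0 (hDF w hw)).2
    lift a to symplOrth Ω D using ha
    lift b to symplOrth Ω D using hb
    refine hj.mkC_mem_eigPreimage_of_eq ?_
    obtain ⟨e, he⟩ := symplProj_surjective D (jq (symplProj Ω D b))
    rw [← he, symplProj_eq_iff]
    refine (symplOrth_symplOrth hΩalt hΩnondeg D).le fun c hc => ?_
    lift c to symplOrth Ω D using hc
    obtain ⟨d, hd⟩ := symplProj_surjective D (jq (symplProj Ω D c))
    have h₁ := (horth d c (hj.mkC_mem_eigPreimage_of_eq hd.symm)).2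
    have h₂ : Ω (e : V) ((-c : symplOrth Ω D) : V) = Ω (b : V) (d : V) :=
      hj.apply_eq hΩalt he.symm (by rw [hd, hj.apply_apply, map_neg])
    rw [Submodule.coe_neg, map_neg] at h₂
    rw [map_sub, LinearMap.sub_apply, h₁, ← h₂]
    simp
  · rintro _ ⟨c, d, rfl, hc, hd⟩ _ ⟨a, b, rfl, ha, hb⟩
    rw [← map_neg] at ha hc
    change ΩC _ _ = 0
    rw [formC_mkC_eq_zero_iff hΩC]
    constructor
    · exact hj.apply_eq hΩalt hb hd
    · have := hj.apply_eq hΩalt ha hd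
      rw [← this]
      simp

lemma IsCLagrangian.le_eigPreimage
    (hΩC : ∀ v w : V, ΩC (iotaC v) (iotaC w) = (Ω v w : ℂ))
    (hF : IsCLagrangian ΩC F) {D : Submodule ℝ V} (hD : realPartOf F = D)
    {jq : Module.End ℝ (symplQuot Ω D)} (hj : EigCond Ω F D jq) :
    F ≤ eigPreimage Ω D jq := by
  subst hD
  intro x hx
  obtain ⟨a, b, rfl⟩ := exists_eq_mkC x
  obtain ⟨ha, hb⟩ := hF.mem_symplOrth hΩC hx
  exact ⟨⟨a, ha⟩, ⟨b, hb⟩, rfl, hj ⟨a, ha⟩ ⟨b, hb⟩ hx⟩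

end Symplectic

/-- the assignment `F ↦ (D, j̃′)` is a bijection between complex
Lagrangian subspaces of `(V,Ω)` and pairs of a real isotropic subspace `D ⊆ V`
and a compatible complex structure `j̃′` on `(D^⊥/D, Ω′)`.  In particular, for a
complex Lagrangian `F`: `D = F ∩ V` is isotropic, `F ∩ F̄ = D^ℂ`,
`(D^⊥)^ℂ = F + F̄`, `(D^⊥/D)^ℂ = F′ ⊕ F̄′`, and `j̃′` exists and is unique;
conversely every pair `(D, j̃′)` arises from a unique complex Lagrangian
`F = p⁻¹(F′)`, with `F ∩ V = D`. -/
theorem stmt19 {V : Type*} [AddCommGroup V] [Module ℝ V] [FiniteDimensional ℝ V]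
    (Ω : V →ₗ[ℝ] V →ₗ[ℝ] ℝ)
    (hΩalt : ∀ v, Ω v v = 0)
    (hΩnondeg : ∀ v, (∀ w, Ω v w = 0) → v = 0)
    -- the ℂ-bilinear extension of Ω to V^ℂ
    (ΩC : ℂ ⊗[ℝ] V →ₗ[ℂ] ℂ ⊗[ℝ] V →ₗ[ℂ] ℂ)
    (hΩC : ∀ v w : V, ΩC (iotaC v) (iotaC w) = (Ω v w : ℂ)) :
    -- forward direction: each complex Lagrangian F determines a pair (D, j̃′)
    (∀ F : Submodule ℂ (ℂ ⊗[ℝ] V), IsCLagrangian ΩC F →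
      -- D = F ∩ V is isotropic
      (∀ v ∈ realPartOf F, ∀ w ∈ realPartOf F, Ω v w = 0)
      -- F ∩ F̄ = D^ℂ
      ∧ F ⊓ Submodule.span ℂ (conjC '' (F : Set (ℂ ⊗[ℝ] V)))
          = Submodule.span ℂ (iotaC '' ((realPartOf F : Submodule ℝ V) : Set V))
      -- (D^⊥)^ℂ = F + F̄
      ∧ Submodule.span ℂ (iotaC '' ((symplOrth Ω (realPartOf F) : Submodule ℝ V) : Set V))
          = F ⊔ Submodule.span ℂ (conjC '' (F : Set (ℂ ⊗[ℝ] V)))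
      -- (D^⊥/D)^ℂ = F′ ⊕ F̄′
      ∧ IsCompl
          (Submodule.span ℂ {y : ℂ ⊗[ℝ] symplQuot Ω (realPartOf F) |
            ∃ a b : ↥(symplOrth Ω (realPartOf F)),
              ((1 : ℂ) ⊗ₜ[ℝ] (a : V) + Complex.I ⊗ₜ[ℝ] (b : V) ∈ F)
              ∧ y = (1 : ℂ) ⊗ₜ[ℝ] (symplProj Ω (realPartOf F) a)
                  + Complex.I ⊗ₜ[ℝ] (symplProj Ω (realPartOf F) b)})
          (Submodule.span ℂ {y : ℂ ⊗[ℝ] symplQuot Ω (realPartOf F) |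
            ∃ a b : ↥(symplOrth Ω (realPartOf F)),
              ((1 : ℂ) ⊗ₜ[ℝ] (a : V) + Complex.I ⊗ₜ[ℝ] (b : V) ∈ F)
              ∧ y = (1 : ℂ) ⊗ₜ[ℝ] (symplProj Ω (realPartOf F) a)
                  - Complex.I ⊗ₜ[ℝ] (symplProj Ω (realPartOf F) b)})
      -- the compatible complex structure j̃′ exists and is unique
      ∧ (∃! jq : Module.End ℝ (symplQuot Ω (realPartOf F)),
          IsCompatQuot Ω (realPartOf F) jq ∧ EigCond Ω F (realPartOf F) jq))
    -- backward direction: each pair (D, j̃′) arises from a unique complex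
    -- Lagrangian F = p⁻¹(F′)
    ∧ (∀ D : Submodule ℝ V, (∀ v ∈ D, ∀ w ∈ D, Ω v w = 0) →
        ∀ jq : Module.End ℝ (symplQuot Ω D), IsCompatQuot Ω D jq →
        ∃ F : Submodule ℂ (ℂ ⊗[ℝ] V),
          (IsCLagrangian ΩC F ∧ realPartOf F = D ∧ EigCond Ω F D jq
            ∧ (F : Set (ℂ ⊗[ℝ] V))
              = {x | ∃ a b : ↥(symplOrth Ω D),
                  x = (1 : ℂ) ⊗ₜ[ℝ] (a : V) + Complex.I ⊗ₜ[ℝ] (b : V)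
                  ∧ jq (symplProj Ω D a) = -(symplProj Ω D b)
                  ∧ jq (symplProj Ω D b) = symplProj Ω D a})
          ∧ ∀ F' : Submodule ℂ (ℂ ⊗[ℝ] V),
              IsCLagrangian ΩC F' → realPartOf F' = D → EigCond Ω F' D jq →
              F' = F) := by
  constructor
  · intro F hF
    refine ⟨hF.isotropic hΩC, ?_, hF.sup_conjC_eq hΩalt hΩnondeg hΩC, ?_,
      hF.existsUnique_compat hΩalt hΩnondeg hΩC⟩
    · rw [inf_conjC_eq, span_iotaC_image]
    · have h := hF.isCompl hΩalt hΩnondeg hΩC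
      simp only [mkC, TensorProduct.tmul_neg, ← sub_eq_add_neg] at h
      exact h
  · intro D hD jq hj
    have hL := hj.isCLagrangian_eigPreimage hΩalt hΩnondeg hΩC hD
    refine ⟨eigPreimage Ω D jq, ⟨hL, hj.realPartOf_eigPreimage hD,
      fun a b h => mkC_mem_eigPreimage.1 h, rfl⟩, fun F' hF' hD' hj' => ?_⟩
    refine Submodule.eq_of_le_of_finrank_eq (hF'.le_eigPreimage hΩC hD' hj') ?_
    have h₁ := hL.2
    have h₂ := hF'.2
    omega
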